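/- Let (Ω, 𝒜) be a measurable space and let X, Y, Z be locally compact separable metric spaces. For a map f : Ω × X × Y → Z, let f̃ : Ω × X → C(Y, Z) be the induced map f̃(ω, x) = f(ω, x, ·), where C(Y, Z) carries the compact-open topology. Then f is measurable and fiberwise continuous if and only if f̃ is measurable and fiberwise continuous. -/

import Mathlib

open TopologicalSpace

/-- A function into `C(Y, Z)` is measurable as soon as its evaluations at all points are. -/
theorem ContinuousMap.measurable_of_eval
    {A Y Z : Type*} [MeasurableSpace A]
    [TopologicalSpace Y] [SecondCountableTopology Y] [LocallyCompactSpace Y]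
    [PseudoEMetricSpace Z] [SecondCountableTopology Z] [MeasurableSpace Z] [BorelSpace Z]
    [MeasurableSpace C(Y, Z)] [BorelSpace C(Y, Z)]
    {F : A → C(Y, Z)} (hF : ∀ y, Measurable fun a => F a y) : Measurable F := by
  rw [BorelSpace.measurable_eq (α := C(Y, Z)),
    borel_eq_generateFrom_of_subbasis (ContinuousMap.compactOpen_eq (X := Y) (Y := Z))]
  refine measurable_generateFrom ?_
  rintro _ ⟨K, hK, U, hU, rfl⟩
  obtain ⟨D, hDc, hD⟩ := exists_countable_dense K
  have key : F ⁻¹' {g : C(Y, Z) | Set.MapsTo g K U} =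
      ⋃ n : ℕ, ⋂ y ∈ D, {a | (n : ENNReal)⁻¹ ≤ Metric.infEDist (F a y) Uᶜ} := by
    ext a
    have hcont : Continuous fun y => Metric.infEDist (F a y) Uᶜ :=
      Metric.continuous_infEDist.comp (F a).continuous
    have hpos (z : Z) : z ∈ U ↔ 0 < Metric.infEDist z Uᶜ := by
      rw [Metric.infEDist_pos_iff_notMem_closure, IsClosed.closure_eq (hU : IsOpen U).isClosed_compl,
        Set.notMem_compl_iff]
    simp only [Set.mem_iUnion, Set.mem_iInter]
    constructor
    · intro h
      rcases K.eq_empty_or_nonempty with rfl | hne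
      · exact ⟨0, fun y => absurd y.2 (Set.notMem_empty _)⟩
      · obtain ⟨y₀, hy₀, hmin⟩ := IsCompact.exists_isMinOn hK hne hcont.continuousOn
        obtain ⟨n, hn⟩ := ENNReal.exists_inv_nat_lt ((hpos _).mp (h hy₀)).ne'
        exact ⟨n, fun y _ => hn.le.trans (hmin y.2)⟩
    · rintro ⟨n, hn⟩ y hy
      have hle : ∀ y : K, (n : ENNReal)⁻¹ ≤ Metric.infEDist (F a y) Uᶜ := fun y =>
        (isClosed_le continuous_const (hcont.comp continuous_subtype_val)).closure_subset_iff.mpr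
          hn (hD y)
      exact (hpos _).mpr ((ENNReal.inv_pos.mpr (ENNReal.natCast_ne_top n)).trans_le (hle ⟨y, hy⟩))
  rw [key]
  refine MeasurableSet.iUnion fun n => MeasurableSet.biInter hDc fun y _ => ?_
  exact measurableSet_le measurable_const (measurable_infEDist.comp (hF y))

/-- Let `(Ω, 𝒜)` be a measurable space and `X, Y, Z` locally compact
separable metric spaces.  A map `f : Ω × X × Y → Z` is measurable and fiberwise continuous
if and only if the induced map `f̃ : Ω × X → C(Y, Z)` (compact-open topology, Borel
σ-algebra) is measurable and fiberwise continuous.  Here `f` is recovered from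
`F = f̃` by `f(ω, x, y) = F(ω, x)(y)`. -/
theorem mfc_iff_mfc_curry
    {Ω X Y Z : Type*} [MeasurableSpace Ω]
    [MetricSpace X] [SeparableSpace X] [LocallyCompactSpace X]
    [MeasurableSpace X] [BorelSpace X]
    [MetricSpace Y] [SeparableSpace Y] [LocallyCompactSpace Y]
    [MeasurableSpace Y] [BorelSpace Y]
    [MetricSpace Z] [SeparableSpace Z] [LocallyCompactSpace Z]
    [MeasurableSpace Z] [BorelSpace Z]
    [MeasurableSpace C(Y, Z)] [BorelSpace C(Y, Z)]
    (F : Ω × X → C(Y, Z)) :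
    (Measurable (fun p : Ω × X × Y => F (p.1, p.2.1) p.2.2) ∧
        ∀ ω : Ω, Continuous (fun q : X × Y => F (ω, q.1) q.2)) ↔
      (Measurable F ∧ ∀ ω : Ω, Continuous (fun x : X => F (ω, x))) := by
  have := UniformSpace.secondCountable_of_separable Y
  have := UniformSpace.secondCountable_of_separable Z
  constructor
  · rintro ⟨hm, hc⟩
    exact ⟨ContinuousMap.measurable_of_eval fun y =>
        hm.comp (measurable_fst.prodMk (measurable_snd.prodMk measurable_const)),
      fun ω => ContinuousMap.continuous_of_continuous_uncurry _ (hc ω)⟩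
  · rintro ⟨hm, hc⟩
    have hev : Measurable fun q : C(Y, Z) × Y => q.1 q.2 := ContinuousEval.continuous_eval.measurable
    exact ⟨hev.comp ((hm.comp (measurable_fst.prodMk measurable_snd.fst)).prodMk
        measurable_snd.snd),
      fun ω => ((hc ω).comp continuous_fst).eval continuous_snd⟩
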